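/- For all x, y ∈ X, as t → ∞ the evolved matrix element E_t(|x⟩⟨y| ⊗ |1̄⟩⟨1̄|) converges (in the finite-dimensional matrix space) to |x⟩⟨y| ⊗ |c̄⟩⟨c̄| if Cⱼ(x) = Cⱼ(y) for every j ∈ Fin N (where c̄ := C̄(x) = C̄(y)), and converges to 0 if there exists j ∈ Fin N with Cⱼ(x) ≠ Cⱼ(y). -/

import Mathlib

open Matrix Filter
open scoped Kronecker Topology

attribute [local instance] Matrix.normedAddCommGroup Matrix.normedSpace

noncomputable section

/-- The computational basis of `n` qubits, `X = {0,1}ⁿ`. -/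
abbrev QubitBasis (n : ℕ) := Fin n → Bool

/-- Evaluation of the 3-literal clause with indices `i₁ i₂ i₃` and bits `b₁ b₂ b₃`:
`C(x) = ¬(x i₁ = b₁ ∧ x i₂ = b₂ ∧ x i₃ = b₃)`. -/
def clauseEval {n : ℕ} (i₁ i₂ i₃ : Fin n) (b₁ b₂ b₃ : Bool) (x : QubitBasis n) : Bool :=
  ! (decide (x i₁ = b₁) && decide (x i₂ = b₂) && decide (x i₃ = b₃))

/-- The Lindblad operator `Lⱼ` attached to the `j`-th clause of an `N`-clause network:
`Lⱼ((x,ā),(y,b̄)) = 1` iff `x = y`, `Cⱼ(x) = false`, `ā j = false`, `b̄ j = true`, and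
`ā k = b̄ k` for all `k ≠ j`. -/
def jumpOpN {n N : ℕ} (C : Fin N → QubitBasis n → Bool) (j : Fin N) :
    Matrix (QubitBasis n × (Fin N → Bool)) (QubitBasis n × (Fin N → Bool)) ℂ :=
  Matrix.of fun p q =>
    if p.1 = q.1 ∧ C j p.1 = false ∧ p.2 j = false ∧ q.2 j = true ∧
        (∀ k, k ≠ j → p.2 k = q.2 k) then 1 else 0

/-- The Lindbladian `ℒ(ρ) = γ (L ρ L† − (1/2)(L†L ρ + ρ L†L))` as a linear endomorphism
of the matrix space. -/
def lindbladian {d : Type*} [Fintype d] [DecidableEq d] (γ : ℝ) (L : Matrix d d ℂ) :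
    Matrix d d ℂ →ₗ[ℂ] Matrix d d ℂ :=
  (γ : ℂ) • ((LinearMap.mulRight ℂ Lᴴ).comp (LinearMap.mulLeft ℂ L)
    - (1 / 2 : ℂ) • (LinearMap.mulLeft ℂ (Lᴴ * L) + LinearMap.mulRight ℂ (Lᴴ * L)))

/-- The evolution `E_t = exp(t·ℒ)`, the exponential of the endomorphism `ℒ`. -/
def evol {d : Type*} [Fintype d] [DecidableEq d]
    (L : Matrix d d ℂ →ₗ[ℂ] Matrix d d ℂ) (t : ℝ) :
    Matrix d d ℂ →L[ℂ] Matrix d d ℂ :=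
  haveI : IsTopologicalRing (Matrix d d ℂ →L[ℂ] Matrix d d ℂ) := by
    have h : ∀ {E : Type _} [NormedAddCommGroup E] [NormedSpace ℂ E],
        IsTopologicalRing (E →L[ℂ] E) := inferInstance
    exact h
  NormedSpace.exp ((t : ℂ) • LinearMap.toContinuousLinearMap L)

theorem exp_unique {E : Type*} [NormedAddCommGroup E] [NormedSpace ℂ E] [CompleteSpace E]
    (A : E →L[ℂ] E) (R : ℝ → E) (hR : ∀ t, HasDerivAt R (A (R t)) t) (t : ℝ) :
    NormedSpace.exp ((t : ℂ) • A) (R 0) = R t := by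
  have h1 : ∀ s : ℝ, HasDerivAt (fun u : ℝ => NormedSpace.exp ((u : ℂ) • A) (R 0))
      (A (NormedSpace.exp ((s : ℂ) • A) (R 0))) s := by
    intro s
    have h := (hasDerivAt_exp_smul_const' (𝕂 := ℂ) A (s : ℂ)).scomp s
      (Complex.ofRealCLM.hasDerivAt (x := s))
    have h2 := ((ContinuousLinearMap.apply ℂ E (R 0)).restrictScalars ℝ).hasFDerivAt.comp_hasDerivAt s h
    simpa [Function.comp_def] using h2
  have := ODE_solution_unique_univ (v := fun _ z => A z) (s := fun _ => Set.univ)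
    (K := ‖A‖₊) (t₀ := 0) (f := fun u : ℝ => NormedSpace.exp ((u : ℂ) • A) (R 0)) (g := R)
    (fun _ => A.lipschitz.lipschitzOnWith) (fun s => ⟨h1 s, trivial⟩) (fun s => ⟨hR s, trivial⟩)
    (by simp)
  exact congrFun this t

section
variable {n N : ℕ} (C : Fin N → QubitBasis n → Bool)

theorem jump_mul (j : Fin N) (M : Matrix (QubitBasis n × (Fin N → Bool)) (QubitBasis n × (Fin N → Bool)) ℂ) (p q) :
    (jumpOpN C j * M) p q =
      if C j p.1 = false ∧ p.2 j = false then M (p.1, Function.update p.2 j true) q else 0 := by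
  rw [Matrix.mul_apply]
  simp only [jumpOpN, Matrix.of_apply, ite_mul, one_mul, zero_mul]
  split_ifs with h
  · rw [Finset.sum_eq_single (p.1, Function.update p.2 j true)]
    · rw [if_pos]
      refine ⟨rfl, h.1, h.2, by simp, fun k hk => by simp [hk]⟩
    · intro b _ hb
      rw [if_neg]
      rintro ⟨h1, -, -, h4, h5⟩
      apply hb
      refine Prod.ext h1.symm (funext fun k => ?_)
      by_cases hk : k = j
      · subst hk; simpa using h4
      · simp [hk, h5 k hk]
    · simp
  · apply Finset.sum_eq_zero
    intro b _
    rw [if_neg]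
    tauto

theorem mul_jumpH (j : Fin N) (M : Matrix (QubitBasis n × (Fin N → Bool)) (QubitBasis n × (Fin N → Bool)) ℂ) (p q) :
    (M * (jumpOpN C j)ᴴ) p q =
      if C j q.1 = false ∧ q.2 j = false then M p (q.1, Function.update q.2 j true) else 0 := by
  have h : M * (jumpOpN C j)ᴴ = (jumpOpN C j * Mᴴ)ᴴ := by simp
  rw [h, Matrix.conjTranspose_apply, jump_mul]
  split_ifs <;> simp

theorem jumpHjump (j : Fin N) :
    (jumpOpN C j)ᴴ * jumpOpN C j =
      Matrix.diagonal fun p => if C j p.1 = false ∧ p.2 j = true then (1 : ℂ) else 0 := by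
  ext p q
  rw [Matrix.mul_apply, Matrix.diagonal_apply]
  simp only [jumpOpN, Matrix.conjTranspose_apply, Matrix.of_apply]
  split_ifs with h h'
  · subst h
    rw [Finset.sum_eq_single (p.1, Function.update p.2 j false)]
    · simp +contextual [h']
    · intro b _ hb
      rw [if_neg]
      · simp
      rintro ⟨h1, -, h3, h4, h5⟩
      apply hb
      refine Prod.ext h1 (funext fun k => ?_)
      by_cases hk : k = j
      · subst hk; simpa using h3
      · simp [hk, h5 k hk]
    · simp
  · subst h
    apply Finset.sum_eq_zero
    intro b _
    rw [if_neg]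
    · simp
    rintro ⟨h1, h2, h3, h4, h5⟩
    rw [h1] at h2
    exact h' ⟨h2, h4⟩
  · apply Finset.sum_eq_zero
    intro b _
    by_cases h1 : (b.1 = p.1 ∧ C j b.1 = false ∧ b.2 j = false ∧ p.2 j = true ∧
        (∀ k, k ≠ j → b.2 k = p.2 k))
    · rw [if_neg (c := b.1 = q.1 ∧ _)]
      · simp
      rintro ⟨h1', -, h3', h4', h5'⟩
      obtain ⟨h1, -, h3, h4, h5⟩ := h1
      apply h
      refine Prod.ext (h1.symm.trans h1') (funext fun k => ?_)
      by_cases hk : k = j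
      · subst hk; rw [h4, h4']
      · rw [← h5 k hk, h5' k hk]
    · rw [if_neg h1]; simp

theorem lind_apply (γ : ℝ) (j : Fin N)
    (M : Matrix (QubitBasis n × (Fin N → Bool)) (QubitBasis n × (Fin N → Bool)) ℂ) (p q) :
    lindbladian γ (jumpOpN C j) M p q = γ * (
      (if (C j p.1 = false ∧ p.2 j = false) ∧ (C j q.1 = false ∧ q.2 j = false) then
        M (p.1, Function.update p.2 j true) (q.1, Function.update q.2 j true) else 0)
      - 1 / 2 * ((if C j p.1 = false ∧ p.2 j = true then 1 else 0)
        + (if C j q.1 = false ∧ q.2 j = true then 1 else 0)) * M p q) := by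
  simp only [lindbladian, LinearMap.smul_apply, LinearMap.sub_apply, LinearMap.comp_apply,
    LinearMap.add_apply, LinearMap.mulLeft_apply, LinearMap.mulRight_apply, jumpHjump,
    Matrix.smul_apply, Matrix.sub_apply, Matrix.add_apply, Matrix.diagonal_mul,
    Matrix.mul_diagonal, mul_jumpH, jump_mul, smul_eq_mul]
  split_ifs <;> first | (exfalso; tauto) | ring

/-- one-ancilla coefficient -/
def gco (γ : ℝ) (cx cy : Bool) (b : Bool) (t : ℝ) : ℂ :=
  if b then ((Real.exp (-(γ / 2 * ((if cx then 0 else 1) + (if cy then 0 else 1))) * t) : ℝ) : ℂ)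
  else if cx = false ∧ cy = false then ((1 - Real.exp (-γ * t) : ℝ) : ℂ) else 0

def gco' (γ : ℝ) (cx cy : Bool) (b : Bool) (t : ℝ) : ℂ :=
  if b then -(γ / 2 * ((if cx then 0 else 1) + (if cy then 0 else 1))) * gco γ cx cy true t
  else if cx = false ∧ cy = false then γ * gco γ cx cy true t else 0

theorem gco_deriv (γ : ℝ) (cx cy b : Bool) (t : ℝ) :
    HasDerivAt (gco γ cx cy b) (gco' γ cx cy b t) t := by
  have h (c : ℝ) : HasDerivAt (fun t : ℝ => Real.exp (c * t)) (Real.exp (c * t) * c) t := by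
    simpa using ((hasDerivAt_id t).const_mul c).exp
  cases b
  · by_cases hc : cx = false ∧ cy = false
    · have := ((h (-γ)).const_sub 1).ofReal_comp
      obtain ⟨rfl, rfl⟩ := hc
      have e' : gco' γ false false false t = ((-(Real.exp (-γ * t) * -γ) : ℝ) : ℂ) := by
        simp [gco', gco]
        ring_nf
      rw [e']
      exact this
    · have e : gco γ cx cy false = fun _ => 0 := by funext s; simp [gco, hc]
      rw [e]
      have e' : gco' γ cx cy false t = 0 := by simp [gco', hc]
      rw [e']; exact hasDerivAt_const _ _
  · have := (h (-(γ / 2 * ((if cx then 0 else 1) + (if cy then 0 else 1))))).ofReal_comp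
    have e' : gco' γ cx cy true t =
        ((Real.exp (-(γ / 2 * ((if cx then 0 else 1) + (if cy then 0 else 1))) * t) *
          -(γ / 2 * ((if cx then 0 else 1) + (if cy then 0 else 1))) : ℝ) : ℂ) := by
      cases cx <;> cases cy <;> simp [gco', gco] <;> ring
    rw [e']
    exact this

def lco (cx cy b : Bool) : ℂ :=
  if cx = cy then (if b = cx then 1 else 0) else 0

theorem gco_lim (γ : ℝ) (hγ : 0 < γ) (cx cy b : Bool) :
    Tendsto (gco γ cx cy b) atTop (𝓝 (lco cx cy b)) := by
  have h (c : ℝ) (hc : c < 0) : Tendsto (fun t : ℝ => Real.exp (c * t)) atTop (𝓝 0) :=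
    Real.tendsto_exp_atBot.comp (tendsto_id.const_mul_atTop_of_neg hc)
  have h' (c : ℝ) (hc : c < 0) : Tendsto (fun t : ℝ => ((Real.exp (c * t) : ℝ) : ℂ)) atTop (𝓝 0) := by
    simpa [Function.comp_def] using (Complex.continuous_ofReal.tendsto 0).comp (h c hc)
  have h1 := h' (-γ) (by linarith)
  have h2 := h' (-(γ / 2)) (by linarith)
  have h3 := h1.const_sub 1
  unfold gco
  cases cx <;> cases cy <;> cases b <;> simp [lco] at h1 h2 h3 ⊢ <;> first | assumption | skip
  convert h1 using 6
  ring

/-- explicit solution -/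
def sol (γ : ℝ) (x y : QubitBasis n) (t : ℝ) :
    Matrix (QubitBasis n × (Fin N → Bool)) (QubitBasis n × (Fin N → Bool)) ℂ :=
  Matrix.of fun p q => if p.1 = x ∧ q.1 = y ∧ p.2 = q.2 then
    ∏ j, gco γ (C j x) (C j y) (p.2 j) t else 0

theorem sol_zero (γ : ℝ) (x y : QubitBasis n) :
    sol C γ x y 0 = Matrix.single (x, fun _ => true) (y, fun _ => true) 1 := by
  have h0 (cx cy b : Bool) : gco γ cx cy b 0 = if b then 1 else 0 := by simp [gco]
  ext p q
  simp only [sol, Matrix.of_apply, h0, Matrix.single_apply, Finset.prod_ite_zero]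
  simp only [Prod.ext_iff, funext_iff, Finset.mem_univ, true_imp_iff, Finset.prod_const_one]
  rw [← ite_and]
  apply if_congr _ rfl rfl
  simp only [← funext_iff]
  grind

theorem sol_lim (γ : ℝ) (hγ : 0 < γ) (x y : QubitBasis n) :
    Tendsto (sol C γ x y) atTop (𝓝 (Matrix.of fun p q => if p.1 = x ∧ q.1 = y ∧ p.2 = q.2 then
    ∏ j, lco (C j x) (C j y) (p.2 j) else 0)) := by
  refine tendsto_pi_nhds.2 ?_; intro p
  refine tendsto_pi_nhds.2 ?_; intro q
  simp only [sol, Matrix.of_apply]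
  split_ifs
  · exact tendsto_finsetProd _ fun j _ => gco_lim γ hγ _ _ _
  · exact tendsto_const_nhds

theorem sol_deriv (γ : ℝ) (x y : QubitBasis n) (t : ℝ) :
    HasDerivAt (sol C γ x y) ((∑ j, lindbladian γ (jumpOpN C j)) (sol C γ x y t)) t := by
  refine hasDerivAt_pi.2 ?_; intro p
  refine hasDerivAt_pi.2 ?_; intro q
  rw [LinearMap.sum_apply, Matrix.sum_apply]
  simp only [lind_apply, sol, Matrix.of_apply]
  by_cases h : p.1 = x ∧ q.1 = y ∧ p.2 = q.2
  · obtain ⟨rfl, rfl, h⟩ := h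
    simp only [← h, and_self, if_true]
    have := HasDerivAt.fun_finsetProd (u := Finset.univ) (x := t)
      (f := fun j => gco γ (C j p.1) (C j q.1) (p.2 j)) (fun j _ => gco_deriv γ _ _ _ t)
    refine HasDerivAt.congr_deriv this (Eq.symm ?_)
    apply Finset.sum_congr rfl
    intro j _
    have e1 := Finset.mul_prod_erase Finset.univ
      (fun k => gco γ (C k p.1) (C k q.1) (p.2 k) t) (Finset.mem_univ j)
    have e2 := Finset.mul_prod_erase Finset.univ
      (fun k => gco γ (C k p.1) (C k q.1) (Function.update p.2 j true k) t) (Finset.mem_univ j)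
    have e3 : ∏ k ∈ Finset.univ.erase j, gco γ (C k p.1) (C k q.1) (Function.update p.2 j true k) t
       = ∏ k ∈ Finset.univ.erase j, gco γ (C k p.1) (C k q.1) (p.2 k) t := by
      apply Finset.prod_congr rfl
      intro k hk
      rw [Function.update_of_ne (Finset.ne_of_mem_erase hk)]
    rw [← e1, ← e2, e3]
    generalize ∏ k ∈ Finset.univ.erase j, gco γ (C k p.1) (C k q.1) (p.2 k) t = P
    simp only [Function.update_self, smul_eq_mul]
    generalize C j p.1 = cx
    generalize C j q.1 = cy
    cases p.2 j <;> cases cx <;> cases cy <;> simp [gco'] <;> ring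
  · simp only [if_neg h]
    convert hasDerivAt_const t (0 : ℂ) using 1
    apply Finset.sum_eq_zero
    intro j _
    rw [mul_zero, sub_zero, mul_eq_zero]
    right
    split_ifs with h1 h2
    · exfalso
      apply h
      refine ⟨h2.1, h2.2.1, funext fun k => ?_⟩
      by_cases hk : k = j
      · subst hk; rw [h1.1.2, h1.2.2]
      · simpa [hk] using congrFun h2.2.2 k
    · rfl
    · rfl

theorem evol_eq (γ : ℝ) (x y : QubitBasis n) (t : ℝ) :
    evol (∑ j, lindbladian γ (jumpOpN C j)) t
      (Matrix.single (x, fun _ => true) (y, fun _ => true) 1) = sol C γ x y t := by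
  rw [← sol_zero C γ]
  exact exp_unique (LinearMap.toContinuousLinearMap (∑ j, lindbladian γ (jumpOpN C j)))
    (sol C γ x y) (fun s => sol_deriv C γ x y s) t
end

theorem evol_matrix_unit_limit {n N : ℕ} (hn : 1 ≤ n) (hN : 1 ≤ N)
    (i₁ i₂ i₃ : Fin N → Fin n)
    (h₁₂ : ∀ j, i₁ j ≠ i₂ j) (h₁₃ : ∀ j, i₁ j ≠ i₃ j) (h₂₃ : ∀ j, i₂ j ≠ i₃ j)
    (b₁ b₂ b₃ : Fin N → Bool) (γ : ℝ) (hγ : 0 < γ)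
    (C : Fin N → QubitBasis n → Bool)
    (hC : ∀ j, C j = clauseEval (i₁ j) (i₂ j) (i₃ j) (b₁ j) (b₂ j) (b₃ j))
    (x y : QubitBasis n) :
    ((∀ j, C j x = C j y) →
      Tendsto
        (fun t : ℝ => evol (∑ j, lindbladian γ (jumpOpN C j)) t
          (Matrix.single (x, fun _ => true) (y, fun _ => true) 1))
        atTop
        (𝓝 (Matrix.single (x, fun j => C j x) (y, fun j => C j y) (1 : ℂ)))) ∧
    ((∃ j, C j x ≠ C j y) →
      Tendsto
        (fun t : ℝ => evol (∑ j, lindbladian γ (jumpOpN C j)) t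
          (Matrix.single (x, fun _ => true) (y, fun _ => true) 1))
        atTop (𝓝 0)) := by
  simp only [evol_eq]
  have hl := sol_lim C γ hγ x y
  refine ⟨fun h => ?_, ?_⟩
  · convert hl using 2
    ext p q
    simp only [Matrix.single_apply, Matrix.of_apply, lco, h, if_true, Finset.prod_ite_zero,
      Finset.mem_univ, true_imp_iff, Finset.prod_const_one]
    rw [← ite_and]
    apply if_congr _ rfl rfl
    simp only [Prod.ext_iff, ← funext_iff]
    grind
  · rintro ⟨j, hj⟩
    convert hl using 2
    ext p q
    have : ∏ j, lco (C j x) (C j y) (p.2 j) = 0 :=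
      Finset.prod_eq_zero (Finset.mem_univ j) (by simp [lco, hj])
    simp [this]
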